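/- arXiv:2402.09698 — 3 statements merged into one kernel-verified Lean document; each statement's English description precedes it below -/
import Mathlib

section
/- Lifting lemma. Let (Ω, 𝒜) be a measurable space carrying two filtrations G ⊆ F, let P be a probability measure on (Ω, 𝒜), let α ∈ (0,1), and let (ξ_t)_{t≥0} be a sequence of events adapted to G (i.e., ξ_t ∈ G_t for every t); set ξ_∞ := limsup_{t→∞} ξ_t = ∩_t ∪_{i≥t} ξ_i, and for a stopping time τ with values in ℕ ∪ {∞} write ξ_τ := {ω ∈ Ω : ω ∈ ξ_{τ(ω)}}. Then the following are equivalent: (a) P(ξ_τ) ≤ α for every G-stopping time τ; (b) P(ξ_τ) ≤ α for every F-stopping time τ. -/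
open MeasureTheory Filter Set
open scoped ENNReal NNReal

namespace SAVI

variable {Ω : Type*}

/-- A stopping time with values in `ℕ ∪ {∞}` with respect to the filtration `G`:
`{τ ≤ t}` is `G t`-measurable for every `t : ℕ`. -/
def IsEStop [mΩ : MeasurableSpace Ω] (G : Filtration ℕ mΩ) (τ : Ω → WithTop ℕ) : Prop :=
  ∀ t : ℕ, MeasurableSet[G t] {ω | τ ω ≤ (t : WithTop ℕ)}

/-- The value of an `ℝ≥0∞`-valued process at an extended stopping time,
interpreted as `limsup_t e t` on the event `{τ = ∞}`. -/
noncomputable def stopVal (e : ℕ → Ω → ℝ≥0∞) (τ : Ω → WithTop ℕ) (ω : Ω) : ℝ≥0∞ :=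
  if h : τ ω = ⊤ then Filter.limsup (fun t => e t ω) Filter.atTop
  else e ((τ ω).untop h) ω

/-- The running maximum `e_t^* = max_{i ≤ t} e_i` of an `ℝ≥0∞`-valued process. -/
noncomputable def runMax (e : ℕ → Ω → ℝ≥0∞) (t : ℕ) (ω : Ω) : ℝ≥0∞ :=
  (Finset.range (t + 1)).sup fun i => e i ω

/-- The event `ξ_τ` obtained by stopping an adapted sequence of events `ξ` at an extended
stopping time `τ`, with `ξ_∞ = limsup_t ξ_t` on `{τ = ∞}`. -/
def stopEventSet (ξ : ℕ → Set Ω) (τ : Ω → WithTop ℕ) : Set Ω :=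
  {ω | (∃ t : ℕ, τ ω = (t : WithTop ℕ) ∧ ω ∈ ξ t) ∨
    (τ ω = ⊤ ∧ ω ∈ Filter.limsup ξ Filter.atTop)}

/-- The event `{p_τ ≤ α}` for a `[0,1]`-valued process `p` stopped at `τ`, interpreted as
`limsup_t {p_t ≤ α}` on `{τ = ∞}`. -/
def stopEventP (p : ℕ → Ω → ℝ) (τ : Ω → WithTop ℕ) (α : ℝ) : Set Ω :=
  {ω | (∃ t : ℕ, τ ω = (t : WithTop ℕ) ∧ p t ω ≤ α) ∨
    (τ ω = ⊤ ∧ ω ∈ Filter.limsup (fun t => {ω' | p t ω' ≤ α}) Filter.atTop)}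

/-- An e-process for the family `𝒩` (composite null) in the filtration `G`: a `G`-adapted
`[0,∞]`-valued process with `e_0 ≤ 1` and `E_P[e_τ] ≤ 1` for every `G`-stopping time `τ`
and every `P ∈ 𝒩`. -/
def IsEProcess [mΩ : MeasurableSpace Ω] (G : Filtration ℕ mΩ) (𝒩 : Set (Measure Ω))
    (e : ℕ → Ω → ℝ≥0∞) : Prop :=
  (∀ t, Measurable[G t] (e t)) ∧ (∀ ω, e 0 ω ≤ 1) ∧
    ∀ τ : Ω → WithTop ℕ, IsEStop G τ → ∀ P ∈ 𝒩, ∫⁻ ω, stopVal e τ ω ∂P ≤ 1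

/-- A p-process for the family `𝒩` in the filtration `G`: a `G`-adapted `[0,1]`-valued
process with `P(p_τ ≤ α) ≤ α` for every `G`-stopping time `τ`, `P ∈ 𝒩`, `α ∈ (0,1)`. -/
def IsPProcess [mΩ : MeasurableSpace Ω] (G : Filtration ℕ mΩ) (𝒩 : Set (Measure Ω))
    (p : ℕ → Ω → ℝ) : Prop :=
  (∀ t, Measurable[G t] (p t)) ∧ (∀ t ω, p t ω ∈ Set.Icc (0 : ℝ) 1) ∧
    ∀ τ : Ω → WithTop ℕ, IsEStop G τ → ∀ P ∈ 𝒩, ∀ α ∈ Set.Ioo (0 : ℝ) 1,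
      P (stopEventP p τ α) ≤ ENNReal.ofReal α

/-- An adjuster: an increasing function `A : [1,∞] → [0,∞]` with `∫_1^∞ A(x)/x² dx ≤ 1`. -/
def IsAdjuster (A : ℝ≥0∞ → ℝ≥0∞) : Prop :=
  MonotoneOn A (Set.Ici 1) ∧
    ∫⁻ x in Set.Ioi (1 : ℝ), A (ENNReal.ofReal x) / ENNReal.ofReal x ^ 2 ≤ 1

/-- An admissible adjuster: additionally right-continuous, `A(∞) = ∞`, and the integral is 1. -/
def IsAdmissibleAdjuster (A : ℝ≥0∞ → ℝ≥0∞) : Prop :=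
  IsAdjuster A ∧ (∀ x ∈ Set.Ici (1 : ℝ≥0∞), ContinuousWithinAt A (Set.Ici x) x) ∧
    A ⊤ = ⊤ ∧ ∫⁻ x in Set.Ioi (1 : ℝ), A (ENNReal.ofReal x) / ENNReal.ofReal x ^ 2 = 1

/-- A p-to-e calibrator: a decreasing function `C : [0,1] → [0,∞]` with `∫_0^1 C(p) dp ≤ 1`. -/
def IsCalibrator (C : ℝ → ℝ≥0∞) : Prop :=
  AntitoneOn C (Set.Icc 0 1) ∧ ∫⁻ p in Set.Icc (0 : ℝ) 1, C p ≤ 1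

/-- The adjusted process `e_0^adj = 1`, `e_t^adj = A(e_t^*)` for `t ≥ 1`. -/
noncomputable def adjProcess (A : ℝ≥0∞ → ℝ≥0∞) (e : ℕ → Ω → ℝ≥0∞) : ℕ → Ω → ℝ≥0∞ :=
  fun t ω => if t = 0 then 1 else A (runMax e t ω)

/-- A test supermartingale for `P` in `G`: nonnegative, `G`-adapted, `M_0 = 1`, and
`E_P[M_t ∣ G_{t-1}] ≤ M_{t-1}`. -/
def IsTestSupermartingale [mΩ : MeasurableSpace Ω] (G : Filtration ℕ mΩ) (P : Measure Ω)
    (M : ℕ → Ω → ℝ) : Prop :=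
  Supermartingale M G P ∧ (∀ t ω, 0 ≤ M t ω) ∧ ∀ ω, M 0 ω = 1

/-- Running maximum of a real-valued process. -/
noncomputable def runMaxR (M : ℕ → Ω → ℝ) (t : ℕ) (ω : Ω) : ℝ :=
  (Finset.range (t + 1)).sup' (Finset.nonempty_range_iff.mpr t.succ_ne_zero) fun i => M i ω

/-- An e-process for the null `𝒩` is `𝒬`-powerful if `limsup_t e_t = ∞` `Q`-a.s. for every
alternative `Q ∈ 𝒬 \ 𝒩`. -/
def IsQPowerful [mΩ : MeasurableSpace Ω] (𝒩 𝒬 : Set (Measure Ω)) (e : ℕ → Ω → ℝ≥0∞) : Prop :=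
  ∀ Q ∈ 𝒬 \ 𝒩, ∀ᵐ ω ∂Q, Filter.limsup (fun t => e t ω) Filter.atTop = ⊤


/-- The first time `t` at which `ω ∈ ξ t`, equal to `⊤` if there is none. -/
noncomputable def firstEntry (ξ : ℕ → Set Ω) (ω : Ω) : WithTop ℕ :=
  open Classical in if h : ∃ t, ω ∈ ξ t then (Nat.find h : WithTop ℕ) else ⊤

lemma firstEntry_le_iff (ξ : ℕ → Set Ω) (ω : Ω) (t : ℕ) :
    firstEntry ξ ω ≤ (t : WithTop ℕ) ↔ ∃ i ≤ t, ω ∈ ξ i := by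
  classical
  unfold firstEntry
  split_ifs with h
  · rw [Nat.cast_le, Nat.find_le_iff]
  · simp only [top_le_iff, WithTop.natCast_ne_top, false_iff]
    exact fun ⟨i, _, hi⟩ => h ⟨i, hi⟩

lemma isEStop_firstEntry [mΩ : MeasurableSpace Ω] {G : Filtration ℕ mΩ} {ξ : ℕ → Set Ω}
    (hξ : ∀ t, MeasurableSet[G t] (ξ t)) : IsEStop G (firstEntry ξ) := by
  intro t
  have h : {ω | firstEntry ξ ω ≤ (t : WithTop ℕ)} = ⋃ i ∈ Set.Iic t, ξ i := by
    ext ω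
    simpa using firstEntry_le_iff ξ ω t
  rw [h]
  exact MeasurableSet.biUnion (Set.to_countable _) fun i hi => G.mono hi _ (hξ i)

lemma stopEventSet_subset_iUnion (ξ : ℕ → Set Ω) (τ : Ω → WithTop ℕ) :
    stopEventSet ξ τ ⊆ ⋃ t, ξ t := by
  rintro ω (⟨t, -, ht⟩ | ⟨-, h⟩)
  · exact Set.mem_iUnion.2 ⟨t, ht⟩
  · exact Set.mem_iUnion.2 (Filter.mem_limsup_iff_frequently_mem.1 h).exists

lemma iUnion_subset_stopEventSet_firstEntry (ξ : ℕ → Set Ω) :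
    ⋃ t, ξ t ⊆ stopEventSet ξ (firstEntry ξ) := by
  classical
  intro ω hω
  have h := Set.mem_iUnion.1 hω
  exact Or.inl ⟨Nat.find h, dif_pos h, Nat.find_spec h⟩

/-- **The lifting lemma.** Let `G ⊆ F` be filtrations (with trivial initial σ-algebra) and let
`(ξ_t)` be a sequence of events adapted to `G`. For a probability measure `P` and `α ∈ (0,1)`,
the bound `P(ξ_τ) ≤ α` holds at every `G`-stopping time `τ` if and only if it holds at every
`F`-stopping time `τ`. -/
theorem lifting_lemma {Ω : Type*} [mΩ : MeasurableSpace Ω]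
    (F G : Filtration ℕ mΩ) (hGF : ∀ t, G t ≤ F t) (hF0 : F 0 = ⊥) (hG0 : G 0 = ⊥)
    (P : Measure Ω) (hP : IsProbabilityMeasure P)
    (α : ℝ) (hα : α ∈ Set.Ioo (0 : ℝ) 1)
    (ξ : ℕ → Set Ω) (hξ : ∀ t, MeasurableSet[G t] (ξ t)) :
    (∀ τ : Ω → WithTop ℕ, IsEStop G τ → P (stopEventSet ξ τ) ≤ ENNReal.ofReal α) ↔
      ∀ τ : Ω → WithTop ℕ, IsEStop F τ → P (stopEventSet ξ τ) ≤ ENNReal.ofReal α := by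
  constructor
  · intro h τ _
    exact (measure_mono ((stopEventSet_subset_iUnion ξ τ).trans
      (iUnion_subset_stopEventSet_firstEntry ξ))).trans (h _ (isEStop_firstEntry hξ))
  · exact fun h τ hτ => h τ fun t => hGF t _ (hτ t)

end SAVI
end

section
/- If A : [1,∞] → [0,∞] is an increasing function that is an adjuster for e-processes — i.e., for every measurable space with filtration G, every family 𝒫 of probability measures, and every e-process (e_t)_{t≥0} for 𝒫 in G, there exists an e-process (e'_t)_{t≥0} for 𝒫 in G with A(e_t^*) ≤ e'_t P-almost surely for all t ≥ 0 and all P ∈ 𝒫 — then A is an adjuster for test supermartingales: for every probability space (Ω, 𝒜, P), every filtration G, and every test supermartingale (M_t)_{t≥0} for P in G, there exists a test supermartingale (M'_t)_{t≥0} for P in G with A(M_t^*) ≤ M'_t P-almost surely for all t ≥ 0. -/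
open MeasureTheory Filter Set
open scoped ENNReal NNReal

namespace SAVI

variable {Ω : Type*}

/-- Condition (a): `A` satisfies the analytic adjuster inequality `∫_1^∞ A(x)/x² dx ≤ 1`. -/
def AdjusterIntegralLeOne (A : ℝ≥0∞ → ℝ≥0∞) : Prop :=
  ∫⁻ x in Set.Ioi (1 : ℝ), A (ENNReal.ofReal x) / ENNReal.ofReal x ^ 2 ≤ 1

/-- Condition (b): `A` is an adjuster for test supermartingales, i.e. for every probability
space, every filtration `G` (with trivial initial σ-algebra), and every test supermartingale
`M` for `P` in `G`, there is a test supermartingale `M'` for `P` in `G` with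
`A(M_t^*) ≤ M'_t` `P`-a.s. for all `t`. -/
def IsAdjusterForTestSupermartingales (A : ℝ≥0∞ → ℝ≥0∞) : Prop :=
  ∀ (Ω : Type) [mΩ : MeasurableSpace Ω] (G : Filtration ℕ mΩ), G 0 = ⊥ →
    ∀ P : Measure Ω, IsProbabilityMeasure P →
      ∀ M : ℕ → Ω → ℝ, IsTestSupermartingale G P M →
        ∃ M' : ℕ → Ω → ℝ, IsTestSupermartingale G P M' ∧
          ∀ t, ∀ᵐ ω ∂P, A (ENNReal.ofReal (runMaxR M t ω)) ≤ ENNReal.ofReal (M' t ω)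

/-- Condition (c): `A` is an adjuster for e-processes, i.e. for every measurable space with a
filtration `G` (with trivial initial σ-algebra), every family `𝒩` of probability measures, and
every e-process `e` for `𝒩` in `G`, there is an e-process `e'` for `𝒩` in `G` with
`A(e_t^*) ≤ e'_t` `P`-a.s. for all `t` and all `P ∈ 𝒩`. -/
def IsAdjusterForEProcesses (A : ℝ≥0∞ → ℝ≥0∞) : Prop :=
  ∀ (Ω : Type) [mΩ : MeasurableSpace Ω] (G : Filtration ℕ mΩ), G 0 = ⊥ →
    ∀ 𝒩 : Set (Measure Ω), (∀ P ∈ 𝒩, IsProbabilityMeasure P) →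
      ∀ e : ℕ → Ω → ℝ≥0∞, IsEProcess G 𝒩 e →
        ∃ e' : ℕ → Ω → ℝ≥0∞, IsEProcess G 𝒩 e' ∧
          ∀ P ∈ 𝒩, ∀ t, ∀ᵐ ω ∂P, A (runMax e t ω) ≤ e' t ω

/-- Condition (d): for every e-process `e` for `𝒩` in `G`, the adjusted process
(`1` at time `0` and `A(e_t^*)` for `t ≥ 1`) is itself an e-process for `𝒩` in `G`. -/
def AdjustedIsEProcessSameFiltration (A : ℝ≥0∞ → ℝ≥0∞) : Prop :=
  ∀ (Ω : Type) [mΩ : MeasurableSpace Ω] (G : Filtration ℕ mΩ), G 0 = ⊥ →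
    ∀ 𝒩 : Set (Measure Ω), (∀ P ∈ 𝒩, IsProbabilityMeasure P) →
      ∀ e : ℕ → Ω → ℝ≥0∞, IsEProcess G 𝒩 e → IsEProcess G 𝒩 (adjProcess A e)

/-- Condition (e): e-lifting. For every e-process `e` for `𝒩` in `G` and every finer filtration
`F ⊇ G`, the adjusted process (`1` at time `0` and `A(e_t^*)` for `t ≥ 1`) is an e-process for
`𝒩` in `F`. -/
def AdjustedIsEProcessFinerFiltration (A : ℝ≥0∞ → ℝ≥0∞) : Prop :=
  ∀ (Ω : Type) [mΩ : MeasurableSpace Ω] (F G : Filtration ℕ mΩ),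
    (∀ t, G t ≤ F t) → F 0 = ⊥ → G 0 = ⊥ →
      ∀ 𝒩 : Set (Measure Ω), (∀ P ∈ 𝒩, IsProbabilityMeasure P) →
        ∀ e : ℕ → Ω → ℝ≥0∞, IsEProcess G 𝒩 e → IsEProcess F 𝒩 (adjProcess A e)

/-- The process `e` stopped at `τ`. -/
noncomputable def stopProc (e : ℕ → Ω → ℝ≥0∞) (τ : Ω → WithTop ℕ) : ℕ → Ω → ℝ≥0∞
  | 0 => e 0
  | n + 1 => {ω | τ ω ≤ (n : WithTop ℕ)}.piecewise (stopProc e τ n) (e (n + 1))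

lemma stopProc_eq_of_forall_lt (e : ℕ → Ω → ℝ≥0∞) (τ : Ω → WithTop ℕ) (n : ℕ) (ω : Ω)
    (h : ∀ m < n, (m : WithTop ℕ) < τ ω) : stopProc e τ n ω = e n ω := by
  cases n with
  | zero => rfl
  | succ n => exact piecewise_eq_of_notMem _ _ _ (not_le.2 (h n n.lt_succ_self))

lemma stopProc_eq_of_le (e : ℕ → Ω → ℝ≥0∞) (τ : Ω → WithTop ℕ) {m n : ℕ} {ω : Ω}
    (h : τ ω = (m : WithTop ℕ)) (hmn : m ≤ n) : stopProc e τ n ω = e m ω := by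
  induction n, hmn using Nat.le_induction with
  | base => exact stopProc_eq_of_forall_lt e τ m ω fun k hk => by rw [h]; exact_mod_cast hk
  | succ n hmn ih =>
    rw [← ih]
    refine piecewise_eq_of_mem _ _ _ ?_
    rw [mem_ofPred_eq, h]
    exact_mod_cast hmn

lemma stopVal_of_eq_coe (e : ℕ → Ω → ℝ≥0∞) {τ : Ω → WithTop ℕ} {ω : Ω} {m : ℕ}
    (h : τ ω = (m : WithTop ℕ)) : stopVal e τ ω = e m ω := by
  have h' : τ ω ≠ ⊤ := by rw [h]; exact WithTop.coe_ne_top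
  have hm : (τ ω).untop h' = m := (WithTop.untop_eq_iff h').2 h
  rw [stopVal, dif_neg h', hm]

lemma stopVal_congr (e : ℕ → Ω → ℝ≥0∞) {τ σ : Ω → WithTop ℕ} {ω : Ω} (h : τ ω = σ ω) :
    stopVal e τ ω = stopVal e σ ω := by
  simp only [stopVal, h]

/-- If `e` converges at `ω`, the value of `e` at `τ` is the limit of the stopped process. -/
lemma tendsto_stopProc (e : ℕ → Ω → ℝ≥0∞) (τ : Ω → WithTop ℕ) {ω : Ω} {c : ℝ≥0∞}
    (hc : Tendsto (fun n => e n ω) atTop (nhds c)) :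
    Tendsto (fun n => stopProc e τ n ω) atTop (nhds (stopVal e τ ω)) := by
  rcases eq_or_ne (τ ω) ⊤ with h | h
  · rw [stopVal, dif_pos h, hc.limsup_eq]
    refine hc.congr fun n => (stopProc_eq_of_forall_lt e τ n ω fun m _ => ?_).symm
    rw [h]
    exact WithTop.coe_lt_top m
  · obtain ⟨m, hm⟩ := WithTop.ne_top_iff_exists.1 h
    rw [stopVal_of_eq_coe e hm.symm]
    exact tendsto_atTop_of_eventually_const fun n hn => stopProc_eq_of_le e τ hm.symm hn

section

variable {mΩ : MeasurableSpace Ω} {G : Filtration ℕ mΩ} {P : Measure Ω} {e : ℕ → Ω → ℝ≥0∞}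
  {τ : Ω → WithTop ℕ}

lemma measurable_stopProc (he : ∀ t, Measurable (e t)) (hτ : IsEStop G τ) (n : ℕ) :
    Measurable (stopProc e τ n) := by
  induction n with
  | zero => exact he 0
  | succ n ih => exact ih.piecewise (G.le n _ (hτ n)) (he _)

lemma lintegral_stopProc_le
    (he : ∀ t s, MeasurableSet[G t] s → ∫⁻ ω in s, e (t + 1) ω ∂P ≤ ∫⁻ ω in s, e t ω ∂P)
    (hτ : IsEStop G τ) (n : ℕ) : ∫⁻ ω, stopProc e τ n ω ∂P ≤ ∫⁻ ω, e 0 ω ∂P := by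
  induction n with
  | zero => exact le_rfl
  | succ n ih =>
    refine le_trans ?_ ih
    set s := {ω | τ ω ≤ (n : WithTop ℕ)}
    have hsm : MeasurableSet s := G.le n _ (hτ n)
    rw [← lintegral_add_compl _ hsm, ← lintegral_add_compl (stopProc e τ n) hsm]
    refine add_le_add (setLIntegral_congr_fun hsm fun ω hω => ?_).le ?_
    · exact piecewise_eq_of_mem _ _ _ hω
    · rw [setLIntegral_congr_fun (g := e (n + 1)) hsm.compl
        fun ω hω => piecewise_eq_of_notMem _ _ _ hω,
        setLIntegral_congr_fun (f := stopProc e τ n) (g := e n) hsm.compl fun ω hω =>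
          stopProc_eq_of_forall_lt e τ n ω fun m hm => lt_trans (by exact_mod_cast hm)
            (not_le.1 hω)]
      exact he n _ (hτ n).compl

/-- Optional stopping for convergent nonnegative supermartingales, at possibly infinite times. -/
lemma lintegral_stopVal_le (hm : ∀ t, Measurable (e t))
    (he : ∀ t s, MeasurableSet[G t] s → ∫⁻ ω in s, e (t + 1) ω ∂P ≤ ∫⁻ ω in s, e t ω ∂P)
    (hlim : ∀ᵐ ω ∂P, ∃ c, Tendsto (fun n => e n ω) atTop (nhds c)) (hτ : IsEStop G τ) :
    ∫⁻ ω, stopVal e τ ω ∂P ≤ ∫⁻ ω, e 0 ω ∂P :=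
  calc
    _ = ∫⁻ ω, liminf (fun n => stopProc e τ n ω) atTop ∂P := by
      refine lintegral_congr_ae ?_
      filter_upwards [hlim] with ω ⟨c, hc⟩
      exact (tendsto_stopProc e τ hc).liminf_eq.symm
    _ ≤ liminf (fun n => ∫⁻ ω, stopProc e τ n ω ∂P) atTop :=
      lintegral_liminf_le (measurable_stopProc hm hτ)
    _ ≤ _ := by
      refine (liminf_le_liminf (.of_forall (lintegral_stopProc_le he hτ))).trans ?_
      rw [liminf_const]

/-- A test supermartingale is an e-process for the singleton null. -/
lemma IsTestSupermartingale.isEProcess [IsProbabilityMeasure P] {M : ℕ → Ω → ℝ}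
    (hM : IsTestSupermartingale G P M) :
    IsEProcess G {P} fun t ω => ENNReal.ofReal (M t ω) := by
  obtain ⟨hS, h0, h1⟩ := hM
  have hle : ∀ i j, i ≤ j → ∀ s, MeasurableSet[G i] s →
      ∫⁻ ω in s, ENNReal.ofReal (M j ω) ∂P ≤ ∫⁻ ω in s, ENNReal.ofReal (M i ω) ∂P := by
    intro i j hij s hs
    rw [← ofReal_integral_eq_lintegral_ofReal (hS.integrable j).integrableOn (.of_forall (h0 j)),
      ← ofReal_integral_eq_lintegral_ofReal (hS.integrable i).integrableOn (.of_forall (h0 i))]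
    exact ENNReal.ofReal_le_ofReal (hS.setIntegral_le hij hs)
  refine ⟨fun t => (hS.1 t).measurable.ennreal_ofReal, fun ω => by simp [h1], ?_⟩
  intro τ hτ Q hQ
  rw [mem_singleton_iff.1 hQ]
  refine (lintegral_stopVal_le
    (fun t => ((hS.1 t).measurable.mono (G.le t) le_rfl).ennreal_ofReal)
    (fun t s hs => hle t (t + 1) t.le_succ s hs) ?_ hτ).trans (by simp [h1])
  have hb : ∀ n, eLpNorm ((-M) n) 1 P ≤ (1 : ℝ≥0) := fun n => by
    have := hle 0 n n.zero_le univ .univ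
    simp only [setLIntegral_univ, h1] at this
    rw [eLpNorm_one_eq_lintegral_enorm]
    simpa [Real.enorm_of_nonneg (h0 n _)] using this
  filter_upwards [hS.neg.exists_ae_tendsto_of_bdd hb] with ω ⟨c, hc⟩
  refine ⟨ENNReal.ofReal (-c), ENNReal.tendsto_ofReal ?_⟩
  simpa using hc.neg

/-- Value iteration for the Snell envelope of `e`. -/
noncomputable def snellIter (G : Filtration ℕ mΩ) (P : Measure Ω) (e : ℕ → Ω → ℝ≥0∞) :
    ℕ → ℕ → Ω → ℝ≥0∞
  | 0 => e
  | n + 1 => fun t => snellIter G P e n t ⊔ P⁻[snellIter G P e n (t + 1)|G t]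

/-- The Snell envelope of `e`. -/
noncomputable def snell (G : Filtration ℕ mΩ) (P : Measure Ω) (e : ℕ → Ω → ℝ≥0∞)
    (t : ℕ) (ω : Ω) : ℝ≥0∞ :=
  ⨆ n, snellIter G P e n t ω

lemma monotone_snellIter (t : ℕ) : Monotone fun n => snellIter G P e n t :=
  monotone_nat_of_le_succ fun _ => le_sup_left

lemma le_snell (t : ℕ) (ω : Ω) : e t ω ≤ snell G P e t ω :=
  le_iSup (fun n => snellIter G P e n t ω) 0

lemma measurable_snellIter (he : ∀ t, Measurable[G t] (e t)) (n t : ℕ) :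
    Measurable[G t] (snellIter G P e n t) := by
  induction n generalizing t with
  | zero => exact he t
  | succ n ih => exact (ih t).sup (measurable_condLExp _ _ _)

lemma measurable_snell (he : ∀ t, Measurable[G t] (e t)) (t : ℕ) :
    Measurable[G t] (snell G P e t) :=
  Measurable.iSup fun n => measurable_snellIter he n t

lemma setLIntegral_snell (he : ∀ t, Measurable[G t] (e t)) (t : ℕ) (s : Set Ω) :
    ∫⁻ ω in s, snell G P e t ω ∂P = ⨆ n, ∫⁻ ω in s, snellIter G P e n t ω ∂P :=
  lintegral_iSup (fun n => (measurable_snellIter he n t).mono (G.le t) le_rfl)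
    (monotone_snellIter t)

lemma setLIntegral_snell_succ_le [IsFiniteMeasure P] (he : ∀ t, Measurable[G t] (e t)) (t : ℕ)
    {s : Set Ω} (hs : MeasurableSet[G t] s) :
    ∫⁻ ω in s, snell G P e (t + 1) ω ∂P ≤ ∫⁻ ω in s, snell G P e t ω ∂P := by
  rw [setLIntegral_snell he, setLIntegral_snell he]
  refine iSup_le fun n => le_iSup_of_le (n + 1) ?_
  rw [← setLIntegral_condLExp (G.le t) P _ hs]
  exact lintegral_mono fun ω => le_sup_right (a := snellIter G P e n t ω)

lemma isEStop_ite {σ : Ω → WithTop ℕ} {t : ℕ} {B : Set Ω} [DecidablePred (· ∈ B)]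
    (hB : MeasurableSet[G t] B) (hτ : IsEStop G τ) (hσ : IsEStop G σ)
    (hτt : ∀ ω, (t : WithTop ℕ) ≤ τ ω) (hσt : ∀ ω, (t : WithTop ℕ) ≤ σ ω) :
    IsEStop G (B.piecewise τ σ) := by
  intro u
  rcases lt_or_ge u t with h | h
  · convert MeasurableSet.empty using 1
    refine eq_empty_of_forall_notMem fun ω hω => ?_
    have h1 : (t : WithTop ℕ) ≤ B.piecewise τ σ ω := by
      by_cases hω' : ω ∈ B <;> simp [hω', hτt, hσt]
    exact absurd (h1.trans hω) (not_le.2 (by exact_mod_cast h))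
  · have : {ω | B.piecewise τ σ ω ≤ (u : WithTop ℕ)} =
        B.ite {ω | τ ω ≤ (u : WithTop ℕ)} {ω | σ ω ≤ (u : WithTop ℕ)} := by
      ext ω
      by_cases hω : ω ∈ B <;> simp [hω, Set.ite]
    rw [this]
    exact MeasurableSet.ite (G.mono h _ hB) (hτ u) (hσ u)

/-- Each iterate is attained by stopping `e` at a suitable stopping time. -/
lemma exists_isEStop_setLIntegral_snellIter [IsFiniteMeasure P]
    (he : ∀ t, Measurable[G t] (e t)) (n t : ℕ) :
    ∃ τ : Ω → WithTop ℕ, IsEStop G τ ∧ (∀ ω, (t : WithTop ℕ) ≤ τ ω) ∧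
      ∀ s, MeasurableSet[G t] s →
        ∫⁻ ω in s, snellIter G P e n t ω ∂P = ∫⁻ ω in s, stopVal e τ ω ∂P := by
  classical
  induction n generalizing t with
  | zero =>
    exact ⟨fun _ => t, isStoppingTime_const G t, fun _ => le_rfl, fun s _ =>
      lintegral_congr fun ω => (stopVal_of_eq_coe e rfl).symm⟩
  | succ n ih =>
    obtain ⟨σ, hσ, hσt, hσi⟩ := ih t
    obtain ⟨ρ, hρ, hρt, hρi⟩ := ih (t + 1)
    have hρt' : ∀ ω, (t : WithTop ℕ) ≤ ρ ω := fun ω =>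
      le_trans (by exact_mod_cast t.le_succ) (hρt ω)
    set f := P⁻[snellIter G P e n (t + 1)|G t] with hf
    set B := {ω | snellIter G P e n t ω ≤ f ω}
    have hB : MeasurableSet[G t] B :=
      measurableSet_le (measurable_snellIter he n t) (measurable_condLExp _ _ _)
    refine ⟨B.piecewise ρ σ, isEStop_ite hB hρ hσ hρt' hσt, fun ω => ?_, fun s hs => ?_⟩
    · by_cases hω : ω ∈ B <;> simp [hω, hρt', hσt]
    · have hB' := G.le t _ hB
      have hs' := G.le t _ hs
      rw [← lintegral_inter_add_sdiff (μ := P) (fun ω => snellIter G P e (n + 1) t ω) s hB',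
        ← lintegral_inter_add_sdiff (μ := P) (stopVal e (B.piecewise ρ σ)) s hB']
      congr 1
      · rw [setLIntegral_congr_fun (f := snellIter G P e (n + 1) t) (g := f) (hs'.inter hB') fun ω hω => sup_eq_right.2 hω.2,
          setLIntegral_congr_fun (g := stopVal e ρ) (hs'.inter hB') fun ω hω =>
            stopVal_congr e (piecewise_eq_of_mem _ _ _ hω.2),
          ← hρi _ (G.mono t.le_succ _ (hs.inter hB)), hf,
          setLIntegral_condLExp (G.le t) P _ (hs.inter hB)]
      · rw [setLIntegral_congr_fun (f := snellIter G P e (n + 1) t) (g := snellIter G P e n t)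
            (hs'.diff hB') fun ω hω =>
            sup_eq_left.2 (le_of_not_ge hω.2),
          setLIntegral_congr_fun (g := stopVal e σ) (hs'.diff hB') fun ω hω =>
            stopVal_congr e (piecewise_eq_of_notMem _ _ _ hω.2), hσi _ (hs.diff hB)]

lemma IsEProcess.lintegral_snell_le_one [IsFiniteMeasure P] (he : IsEProcess G {P} e) (t : ℕ) :
    ∫⁻ ω, snell G P e t ω ∂P ≤ 1 := by
  rw [← setLIntegral_univ, setLIntegral_snell he.1]
  refine iSup_le fun n => ?_
  obtain ⟨τ, hτ, -, hi⟩ := exists_isEStop_setLIntegral_snellIter (P := P) he.1 n t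
  rw [hi _ .univ, setLIntegral_univ]
  exact he.2.2 τ hτ P rfl

lemma IsEProcess.snell_zero_le_one [IsProbabilityMeasure P] (hG : G 0 = ⊥)
    (he : IsEProcess G {P} e) (ω : Ω) : snell G P e 0 ω ≤ 1 := by
  have hm := measurable_snell (P := P) he.1 0
  rw [hG] at hm
  obtain ⟨c, hc⟩ := eq_const_of_measurable_bot hm
  have := he.lintegral_snell_le_one 0
  simpa [hc] using this

/-- Every e-process for a single measure is dominated by a test supermartingale. -/
lemma IsEProcess.exists_isTestSupermartingale [IsProbabilityMeasure P] (hG : G 0 = ⊥)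
    (he : IsEProcess G {P} e) :
    ∃ M : ℕ → Ω → ℝ, IsTestSupermartingale G P M ∧
      ∀ t, ∀ᵐ ω ∂P, e t ω ≤ ENNReal.ofReal (M t ω) := by
  set S : ℕ → Ω → ℝ≥0∞ := fun t => if t = 0 then 1 else snell G P e t with hS
  have hSm : ∀ t, Measurable[G t] (S t) := fun t => by
    by_cases h : t = 0
    · simp only [hS, h, if_true]
      exact stronglyMeasurable_one.measurable
    · simpa [hS, h] using measurable_snell he.1 t
  have hSm' : ∀ t, Measurable (S t) := fun t => (hSm t).mono (G.le t) le_rfl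
  have hle : ∀ t ω, snell G P e t ω ≤ S t ω := fun t ω => by
    by_cases h : t = 0
    · simpa [hS, h] using he.snell_zero_le_one hG ω
    · simp [hS, h]
  have hi : ∀ t, ∫⁻ ω, S t ω ∂P ≠ ∞ := fun t => by
    by_cases h : t = 0
    · simp [hS, h]
    · simpa [hS, h] using ne_top_of_le_ne_top ENNReal.one_ne_top (he.lintegral_snell_le_one t)
  have hfin : ∀ t, ∀ᵐ ω ∂P, S t ω < ∞ := fun t => ae_lt_top (hSm' t) (hi t)
  refine ⟨fun t ω => (S t ω).toReal, ⟨?_, fun _ _ => ENNReal.toReal_nonneg, fun _ => by simp [hS]⟩,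
    fun t => ?_⟩
  · refine supermartingale_of_setIntegral_succ_le
      (fun t => (hSm t).ennreal_toReal.stronglyMeasurable)
      (fun t => integrable_toReal_of_lintegral_ne_top (hSm' t).aemeasurable (hi t))
      fun t s hs => ?_
    rw [integral_toReal (hSm' _).aemeasurable (ae_restrict_of_ae (hfin _)),
      integral_toReal (hSm' _).aemeasurable (ae_restrict_of_ae (hfin _))]
    refine ENNReal.toReal_mono (ne_top_of_le_ne_top (hi t) (setLIntegral_le_lintegral _ _)) ?_
    calc
      _ = ∫⁻ ω in s, snell G P e (t + 1) ω ∂P := by simp [hS]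
      _ ≤ ∫⁻ ω in s, snell G P e t ω ∂P := setLIntegral_snell_succ_le he.1 t hs
      _ ≤ _ := lintegral_mono (hle t)
  · filter_upwards [hfin t] with ω hω
    rw [ENNReal.ofReal_toReal hω.ne]
    exact (le_snell t ω).trans (hle t ω)

end

lemma ofReal_runMaxR (M : ℕ → Ω → ℝ) (t : ℕ) (ω : Ω) :
    ENNReal.ofReal (runMaxR M t ω) = runMax (fun t ω => ENNReal.ofReal (M t ω)) t ω := by
  rw [runMaxR, runMax, ← Finset.sup'_eq_sup (Finset.nonempty_range_iff.mpr t.succ_ne_zero)]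
  exact Finset.apply_sup'_eq_sup'_comp _ _ fun _ _ => ENNReal.ofReal_mono.map_max

/-- If an increasing function `A : [1,∞] → [0,∞]` is an adjuster for e-processes, then it is an
adjuster for test supermartingales. -/
theorem adjusterForE_implies_adjusterForTSM (A : ℝ≥0∞ → ℝ≥0∞)
    (hA : MonotoneOn A (Set.Ici 1)) (h : IsAdjusterForEProcesses A) :
    IsAdjusterForTestSupermartingales A := by
  intro Ω mΩ G hG P hP M hM
  obtain ⟨e, he, hAe⟩ := h Ω G hG {P} (fun Q hQ => hQ ▸ hP) _ hM.isEProcess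
  obtain ⟨M', hM', hle⟩ := he.exists_isTestSupermartingale hG
  refine ⟨M', hM', fun t => ?_⟩
  filter_upwards [hAe P rfl t, hle t] with ω h1 h2
  rw [ofReal_runMaxR]
  exact h1.trans h2

end SAVI
end

section
/- One-to-one correspondence between p-to-e calibrators and adjusters. Let C : [0,1] → [0,∞] be a decreasing function and define A : [1,∞) → [0,∞] by A(x) := C(1/x). Then ∫_1^∞ A(x)/x² dx = ∫_0^1 C(p) dp. Consequently, C satisfies ∫_0^1 C(p) dp ≤ 1 (C is a p-to-e calibrator) if and only if the increasing function A satisfies ∫_1^∞ A(x)/x² dx ≤ 1 (A is an adjuster), and the same equivalence holds with equality in place of the inequalities. -/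
open MeasureTheory Filter Set
open scoped ENNReal NNReal

namespace SAVI

variable {Ω : Type*}

theorem image_inv_Ioi_one : (fun x : ℝ => x⁻¹) '' Ioi 1 = Ioo 0 1 := by
  rw [image_inv_eq_inv, inv_Ioi₀ one_pos, inv_one]

/-- The substitution `p = 1 / x` maps the integral over `[0,1]` to one over `(1,∞)`. -/
theorem lintegral_Ioi_one_inv_div_sq (f : ℝ → ℝ≥0∞) :
    ∫⁻ x in Ioi (1 : ℝ), f x⁻¹ / ENNReal.ofReal x ^ 2 = ∫⁻ p in Icc (0 : ℝ) 1, f p := by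
  rw [setLIntegral_congr Ioo_ae_eq_Icc.symm, ← image_inv_Ioi_one,
    lintegral_image_eq_lintegral_abs_deriv_mul measurableSet_Ioi
      (fun x hx => (hasDerivAt_inv (zero_lt_one.trans hx).ne').hasDerivWithinAt)
      inv_injective.injOn]
  refine setLIntegral_congr_fun measurableSet_Ioi fun x hx => ?_
  have hx0 : 0 < x := zero_lt_one.trans hx
  rw [abs_neg, abs_of_pos (inv_pos.2 (pow_pos hx0 2)), ENNReal.ofReal_inv_of_pos (pow_pos hx0 2),
    ENNReal.ofReal_pow hx0.le, ENNReal.div_eq_inv_mul]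

/-- **One-to-one correspondence between p-to-e calibrators and adjusters.** Let `C` be a
decreasing function on `[0,1]` and set `A(x) := C(1/x)` for `x ≥ 1`. Then `A` is increasing on
`[1,∞)` and `∫_1^∞ A(x)/x² dx = ∫_0^1 C(p) dp`; consequently `C` is a p-to-e calibrator
(`∫_0^1 C ≤ 1`) iff `A` is an adjuster (`∫_1^∞ A(x)/x² dx ≤ 1`), and likewise with equality. -/
theorem calibrator_adjuster_correspondence (C : ℝ → ℝ≥0∞)
    (hC : AntitoneOn C (Set.Icc 0 1)) :
    MonotoneOn (fun x : ℝ => C x⁻¹) (Set.Ici 1) ∧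
      (∫⁻ x in Set.Ioi (1 : ℝ), C x⁻¹ / ENNReal.ofReal x ^ 2
        = ∫⁻ p in Set.Icc (0 : ℝ) 1, C p) ∧
      ((∫⁻ p in Set.Icc (0 : ℝ) 1, C p ≤ 1)
        ↔ ∫⁻ x in Set.Ioi (1 : ℝ), C x⁻¹ / ENNReal.ofReal x ^ 2 ≤ 1) ∧
      ((∫⁻ p in Set.Icc (0 : ℝ) 1, C p = 1)
        ↔ ∫⁻ x in Set.Ioi (1 : ℝ), C x⁻¹ / ENNReal.ofReal x ^ 2 = 1) := by
  refine ⟨fun x hx y hy hxy => ?_, lintegral_Ioi_one_inv_div_sq C, ?_, ?_⟩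
  · have hx0 : 0 < x := zero_lt_one.trans_le hx
    have hy0 : 0 < y := zero_lt_one.trans_le hy
    exact hC ⟨inv_nonneg.2 hy0.le, inv_le_one_of_one_le₀ hy⟩
      ⟨inv_nonneg.2 hx0.le, inv_le_one_of_one_le₀ hx⟩ (inv_anti₀ hx0 hxy)
  all_goals rw [lintegral_Ioi_one_inv_div_sq]

end SAVI
end
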